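/- Let n and d be positive integers with d ∣ n. Let K_GL denote the kernel of the entrywise reduction homomorphism GL₂(ℤ/nℤ) → GL₂(ℤ/dℤ), and let K_B denote the kernel of the entrywise reduction homomorphism B(n) → B(d). Then #K_GL · d · ∏_{p prime, p ∣ n, p ∤ d} p = #K_B · n · ∏_{p prime, p ∣ n, p ∤ d} (p + 1); equivalently, #K_GL / #K_B = ∏_{p ∣ d} p^{a_p − b_p} · ∏_{p ∣ n, p ∤ d} p^{a_p − 1}(p + 1), which equals the degree of the natural map X₀(n) → X₀(d). -/

import Mathlib

open Matrix

theorem isCoprime_of_isUnit_left {R : Type*} [CommSemiring R] {a : R} (ha : IsUnit a) (b : R) :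
    IsCoprime a b := by
  obtain ⟨u, rfl⟩ := ha
  exact ⟨↑u⁻¹, 0, by simp⟩

theorem card_subtype_isUnit (R : Type*) [Monoid R] :
    Nat.card {x : R // IsUnit x} = Nat.card Rˣ :=
  Nat.card_congr (Equiv.ofBijective (fun u : Rˣ => (⟨u, u.isUnit⟩ : {x : R // IsUnit x}))
    ⟨fun _ _ h => Units.ext (congrArg Subtype.val h), fun ⟨_, u, hu⟩ => ⟨u, Subtype.ext hu⟩⟩).symm

theorem isLocalRing_zmod_prime_pow {p k : ℕ} (hp : p.Prime) (hk : 0 < k) :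
    IsLocalRing (ZMod (p ^ k)) := by
  have : Fact (1 < p ^ k) := ⟨Nat.one_lt_pow hk.ne' hp.one_lt⟩
  have : Fact p.Prime := ⟨hp⟩
  have hdvd : p ∣ p ^ k := dvd_pow_self p hk.ne'
  have key : ∀ a : ZMod (p ^ k), a ∈ nonunits (ZMod (p ^ k)) ↔
      ZMod.castHom hdvd (ZMod p) a = 0 := by
    intro a
    obtain ⟨m, rfl⟩ := ZMod.natCast_zmod_surjective a
    rw [mem_nonunits_iff, ZMod.isUnit_iff_coprime, Nat.coprime_pow_right_iff hk, Nat.coprime_comm,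
      hp.coprime_iff_not_dvd, not_not, map_natCast, ZMod.natCast_eq_zero_iff]
  refine IsLocalRing.of_nonunits_add fun a b ha hb => ?_
  rw [key] at ha hb ⊢
  rw [map_add, ha, hb, add_zero]

theorem card_pairs_isCoprime_of_isLocalRing (R : Type*) [CommRing R] [Finite R] [IsLocalRing R] :
    Nat.card {z : R × R // IsCoprime z.1 z.2} =
      Nat.card Rˣ * (Nat.card R + (Nat.card R - Nat.card Rˣ)) := by
  classical
  have hu : Nat.card {x : R // IsUnit x} = Nat.card Rˣ :=
    card_subtype_isUnit R
  have hc : Nat.card {x : R // ¬ IsUnit x} = Nat.card R - Nat.card Rˣ := by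
    have := Nat.card_congr (Equiv.sumCompl (fun x : R => IsUnit x))
    rw [Nat.card_sum, hu] at this
    omega
  have hN : Nat.card {z : R × R // ¬ IsCoprime z.1 z.2} =
      (Nat.card R - Nat.card Rˣ) * (Nat.card R - Nat.card Rˣ) := by
    rw [← hc, ← Nat.card_prod]
    refine Nat.card_congr ((Equiv.subtypeEquivRight fun z => ?_).trans
      (Equiv.subtypeProdEquivProd (p := fun x : R => ¬ IsUnit x) (q := fun x : R => ¬ IsUnit x)))
    rw [← not_or, not_iff_not]
    constructor
    · rintro ⟨a, b, h⟩
      exact (IsLocalRing.isUnit_or_isUnit_of_add_one h).imp isUnit_of_mul_isUnit_right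
        isUnit_of_mul_isUnit_right
    · rintro (h | h)
      · exact isCoprime_of_isUnit_left h _
      · exact (isCoprime_of_isUnit_left h _).symm
  have hT := Nat.card_congr (Equiv.sumCompl (fun z : R × R => IsCoprime z.1 z.2))
  rw [Nat.card_sum, hN, Nat.card_prod] at hT
  obtain ⟨c, hc'⟩ : ∃ c, Nat.card R = Nat.card Rˣ + c :=
    Nat.exists_eq_add_of_le (hu ▸ Finite.card_subtype_le _)
  rw [hc'] at hT ⊢
  simp only [Nat.add_sub_cancel_left] at hT ⊢
  nlinarith

theorem card_pairs_isCoprime_one_add_prod (d : ℕ) (R S : Type*) [CommRing R] [CommRing S] :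
    Nat.card {z : (R × S) × (R × S) // IsCoprime (1 + d * z.1) z.2} =
      Nat.card {z : R × R // IsCoprime (1 + d * z.1) z.2} *
        Nat.card {z : S × S // IsCoprime (1 + d * z.1) z.2} := by
  rw [← Nat.card_prod]
  refine Nat.card_congr (((Equiv.prodProdProdComm R S R S).subtypeEquiv fun z => ?_).trans
    (Equiv.subtypeProdEquivProd (p := fun z : R × R => IsCoprime (1 + d * z.1) z.2)
      (q := fun z : S × S => IsCoprime (1 + d * z.1) z.2)))
  constructor
  · intro h
    exact ⟨by simpa using h.map (RingHom.fst R S), by simpa using h.map (RingHom.snd R S)⟩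
  · rintro ⟨⟨a, b, h⟩, ⟨a', b', h'⟩⟩
    exact ⟨(a, a'), (b, b'), Prod.ext (by simpa using h) (by simpa using h')⟩

theorem card_isUnit_one_add_prod (d : ℕ) (R S : Type*) [CommRing R] [CommRing S] :
    Nat.card {z : R × S // IsUnit (1 + d * z)} =
      Nat.card {x : R // IsUnit (1 + d * x)} * Nat.card {x : S // IsUnit (1 + d * x)} := by
  rw [← Nat.card_prod]
  refine Nat.card_congr ((Equiv.subtypeEquivRight fun z => ?_).trans
    (Equiv.subtypeProdEquivProd (p := fun x : R => IsUnit (1 + d * x))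
      (q := fun x : S => IsUnit (1 + d * x))))
  rw [Prod.isUnit_iff]
  simp

/-- For `d ∣ n`, the product of `d` and the degree of `X₀(n) → X₀(d)`, as a product over primes. -/
def relativeDegree (n d : ℕ) : ℕ :=
  ∏ p ∈ n.primeFactors,
    if p ∣ d then p ^ n.factorization p else p ^ (n.factorization p - 1) * (p + 1)

theorem relativeDegree_mul {a b : ℕ} (d : ℕ) (hab : a.Coprime b) :
    relativeDegree (a * b) d = relativeDegree a d * relativeDegree b d := by
  unfold relativeDegree
  rw [hab.primeFactors_mul, Finset.prod_union hab.disjoint_primeFactors]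
  congr 1
  · refine Finset.prod_congr rfl fun p hp => ?_
    rw [Nat.factorization_eq_of_coprime_left hab (by simpa using hp)]
  · refine Finset.prod_congr rfl fun p hp => ?_
    rw [Nat.factorization_eq_of_coprime_right hab (by simpa using hp)]

theorem card_pairs_isCoprime_one_add_prime_pow {p k : ℕ} (d : ℕ) (hp : p.Prime) (hk : 0 < k) :
    Nat.card {z : ZMod (p ^ k) × ZMod (p ^ k) // IsCoprime (1 + d * z.1) z.2} =
      Nat.card {x : ZMod (p ^ k) // IsUnit (1 + d * x)} * relativeDegree (p ^ k) d := by
  have := isLocalRing_zmod_prime_pow hp hk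
  have : NeZero (p ^ k) := ⟨pow_ne_zero k hp.ne_zero⟩
  have hdeg : relativeDegree (p ^ k) d =
      if p ∣ d then p ^ k else p ^ (k - 1) * (p + 1) := by
    simp [relativeDegree, Nat.primeFactors_prime_pow hk.ne' hp, hp.factorization_self]
  rw [hdeg]
  have hcop : IsUnit (d : ZMod (p ^ k)) ↔ ¬ p ∣ d := by
    rw [ZMod.isUnit_iff_coprime, Nat.coprime_pow_right_iff hk, Nat.coprime_comm,
      hp.coprime_iff_not_dvd]
  split_ifs with h
  · have hu : ∀ x : ZMod (p ^ k), IsUnit (1 + d * x) := by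
      intro x
      have h1 : IsUnit ((1 + d * x) + -(d * x)) := by simp
      refine (IsLocalRing.isUnit_or_isUnit_of_isUnit_add h1).resolve_right fun h2 => ?_
      exact hcop.1 (isUnit_of_mul_isUnit_left ((IsUnit.neg_iff _).1 h2)) h
    rw [Nat.card_congr (Equiv.subtypeUnivEquiv fun z => isCoprime_of_isUnit_left (hu _) _),
      Nat.card_congr (Equiv.subtypeUnivEquiv hu), Nat.card_prod, Nat.card_zmod]
  · obtain ⟨u, hu⟩ := hcop.2 h
    let e : ZMod (p ^ k) ≃ ZMod (p ^ k) := u.mulLeft.trans (Equiv.addLeft 1)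
    have he : ∀ x, e x = 1 + d * x := fun x => by simp [e, hu]
    rw [Nat.card_congr ((e.prodCongr (Equiv.refl _)).subtypeEquiv
        (q := fun z => IsCoprime z.1 z.2) fun z => by simp [he]),
      Nat.card_congr (e.subtypeEquiv (q := fun x => IsUnit x) fun z => by simp [he]),
      card_pairs_isCoprime_of_isLocalRing, card_subtype_isUnit,
      Nat.card_zmod, Nat.card_eq_fintype_card, ZMod.card_units_eq_totient,
      Nat.totient_prime_pow hp hk]
    congr 1
    obtain ⟨j, rfl⟩ := Nat.exists_eq_succ_of_ne_zero hk.ne'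
    obtain ⟨q, rfl⟩ := Nat.exists_eq_succ_of_ne_zero hp.ne_zero
    simp only [Nat.succ_eq_add_one, Nat.add_sub_cancel, pow_succ]
    rw [← Nat.mul_sub, Nat.add_sub_cancel_left]
    ring

theorem card_pairs_isCoprime_one_add (d n : ℕ) (hn : n ≠ 0) :
    Nat.card {z : ZMod n × ZMod n // IsCoprime (1 + d * z.1) z.2} =
      Nat.card {x : ZMod n // IsUnit (1 + d * x)} * relativeDegree n d := by
  induction n using Nat.recOnPosPrimePosCoprime with
  | prime_pow p k hp hk => exact card_pairs_isCoprime_one_add_prime_pow d hp hk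
  | zero => exact absurd rfl hn
  | one =>
    have h1 : ∀ z : ZMod 1 × ZMod 1, IsCoprime (1 + d * z.1) z.2 := fun z =>
      ⟨0, 0, Subsingleton.elim _ _⟩
    have h2 : ∀ x : ZMod 1, IsUnit (1 + d * x) := fun x => isUnit_of_subsingleton _
    rw [Nat.card_congr (Equiv.subtypeUnivEquiv h1), Nat.card_congr (Equiv.subtypeUnivEquiv h2),
      Nat.card_prod, Nat.card_zmod]
    simp [relativeDegree]
  | coprime a b ha hb hab iha ihb =>
    let e := ZMod.chineseRemainder hab
    have hF : Nat.card {z : ZMod (a * b) × ZMod (a * b) // IsCoprime (1 + d * z.1) z.2} =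
        Nat.card {z : (ZMod a × ZMod b) × (ZMod a × ZMod b) // IsCoprime (1 + d * z.1) z.2} :=
      Nat.card_congr ((e.toEquiv.prodCongr e.toEquiv).subtypeEquiv fun z =>
        ⟨fun h => by simpa using h.map e.toRingHom,
          fun h => by simpa using h.map e.symm.toRingHom⟩)
    have hG : Nat.card {x : ZMod (a * b) // IsUnit (1 + d * x)} =
        Nat.card {x : ZMod a × ZMod b // IsUnit (1 + d * x)} :=
      Nat.card_congr (e.toEquiv.subtypeEquiv fun z =>
        ⟨fun h => by simpa using h.map e.toRingHom,
          fun h => by simpa using h.map e.symm.toRingHom⟩)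
    rw [hF, hG, card_pairs_isCoprime_one_add_prod, card_isUnit_one_add_prod,
      relativeDegree_mul d hab, iha (by omega), ihb (by omega)]
    ring

theorem card_subtype_comp_of_surjective {A B : Type*} [AddGroup A] [AddGroup B] [Finite A]
    (f : A →+ B) (P : B → Prop) (hP : ∀ b, P b → b ∈ f.range) :
    Nat.card {a // P (f a)} = Nat.card {b // P b} * Nat.card f.ker := by
  have e : ∀ b : {b // P b}, {a // f a = b} ≃ f.ker := fun b =>
    let a := (hP b b.2).choose
    have ha : f a = b := (hP b b.2).choose_spec
    (Equiv.addLeft (-a)).subtypeEquiv fun x => by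
      simp only [Equiv.coe_addLeft, AddMonoidHom.mem_ker, map_add, map_neg, ha]
      rw [neg_add_eq_zero, eq_comm]
  rw [← Nat.card_prod]
  exact Nat.card_congr ((Equiv.sigmaSubtypeFiberEquivSubtype f fun _ => Iff.rfl).symm.trans
    ((Equiv.sigmaCongrRight e).trans (Equiv.sigmaEquivProd _ _)))

theorem range_mulLeft_natCast {n d : ℕ} [NeZero n] (hdn : d ∣ n) (x : ZMod n) :
    x ∈ (AddMonoidHom.mulLeft (d : ZMod n)).range ↔ ZMod.castHom hdn (ZMod d) x = 0 := by
  constructor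
  · rintro ⟨y, rfl⟩
    rw [AddMonoidHom.coe_mulLeft, map_mul, map_natCast, ZMod.natCast_self, zero_mul]
  · intro hx
    obtain ⟨m, rfl⟩ := ZMod.natCast_zmod_surjective x
    rw [map_natCast, ZMod.natCast_eq_zero_iff] at hx
    obtain ⟨k, rfl⟩ := hx
    exact ⟨k, by simp⟩

theorem card_ker_mulLeft_natCast {n d : ℕ} [NeZero n] (hdn : d ∣ n) :
    Nat.card (AddMonoidHom.mulLeft (d : ZMod n)).ker = d := by
  have hd : NeZero d := ⟨fun h => NeZero.ne n (Nat.eq_zero_of_zero_dvd (h ▸ hdn))⟩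
  set f := AddMonoidHom.mulLeft (d : ZMod n)
  set g := (ZMod.castHom hdn (ZMod d)).toAddMonoidHom
  have hf : Nat.card (ZMod n) = Nat.card f.range * Nat.card f.ker := by
    rw [← f.ker.card_mul_index, AddSubgroup.index_ker, mul_comm]
  have hg : Nat.card (ZMod n) = Nat.card g.ker * d := by
    rw [← g.ker.card_mul_index, AddSubgroup.index_ker,
      AddMonoidHom.range_eq_top.2 (ZMod.castHom_surjective hdn), AddSubgroup.card_top, Nat.card_zmod]
  have hfg : f.range = g.ker := by
    ext x
    exact range_mulLeft_natCast hdn x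
  rw [hfg, hg] at hf
  exact (Nat.eq_of_mul_eq_mul_left Nat.card_pos hf).symm

theorem card_subgroup_eq_card_image_mul {G X : Type*} [Group G] (H S : Subgroup G) (hS : S ≤ H)
    (f : G → X) (hf : ∀ g ∈ H, ∀ h ∈ H, f g = f h ↔ g⁻¹ * h ∈ S) :
    Nat.card H = Nat.card (f '' H) * Nat.card S := by
  rw [(S.subgroupOf H).card_eq_card_quotient_mul_card_subgroup,
    Nat.card_congr (Subgroup.subgroupOfEquivOfLe hS).toEquiv]
  congr 1
  refine Nat.card_congr (Equiv.ofBijective (Quotient.lift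
    (fun g : H => (⟨f g, g, g.2, rfl⟩ : f '' H)) fun a b hab => ?_) ⟨?_, ?_⟩)
  · rw [← Quotient.eq_iff_equiv] at hab
    have := QuotientGroup.eq.1 hab
    exact Subtype.ext ((hf a a.2 b b.2).2 (by simpa [Subgroup.mem_subgroupOf] using this))
  · rintro ⟨a⟩ ⟨b⟩ hab
    refine QuotientGroup.eq.2 ?_
    have := (hf a a.2 b b.2).1 (congrArg Subtype.val hab)
    simpa [Subgroup.mem_subgroupOf] using this
  · rintro ⟨_, g, hg, rfl⟩
    exact ⟨Quotient.mk'' ⟨g, hg⟩, rfl⟩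

/-- The subgroup of upper-triangular matrices of `GL₂(R)`. -/
def upperTriangularGL (R : Type*) [CommRing R] : Subgroup (GL (Fin 2) R) where
  carrier := {M | M.1 1 0 = 0}
  one_mem' := by simp
  mul_mem' := by
    intro a b ha hb
    simp_all [Matrix.mul_apply, Fin.sum_univ_two]
  inv_mem' := by
    intro a ha
    have : a.1 1 0 = 0 := ha
    simp [Matrix.inv_def, Matrix.adjugate_fin_two, this]

/-- The stabilizer in `GL₂(R)` of a vector. -/
def mulVecStabilizer {R : Type*} [CommRing R] (v : Fin 2 → R) : Subgroup (GL (Fin 2) R) where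
  carrier := {M | M.1 *ᵥ v = v}
  one_mem' := Matrix.one_mulVec v
  mul_mem' := by
    intro a b (ha : a.1 *ᵥ v = v) (hb : b.1 *ᵥ v = v)
    change (a.1 * b.1) *ᵥ v = v
    rw [← Matrix.mulVec_mulVec, hb, ha]
  inv_mem' := by
    intro a (ha : a.1 *ᵥ v = v)
    change a⁻¹.1 *ᵥ v = v
    conv_lhs => rw [← ha]
    rw [Matrix.mulVec_mulVec, Units.inv_mul, Matrix.one_mulVec]

theorem inv_mul_mem_mulVecStabilizer {R : Type*} [CommRing R] (v : Fin 2 → R)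
    (g h : GL (Fin 2) R) : g⁻¹ * h ∈ mulVecStabilizer v ↔ g.1 *ᵥ v = h.1 *ᵥ v := by
  change (g⁻¹.1 * h.1) *ᵥ v = v ↔ _
  rw [← Matrix.mulVec_mulVec]
  constructor
  · intro H
    conv_lhs => rw [← H]
    rw [Matrix.mulVec_mulVec, Units.mul_inv, Matrix.one_mulVec]
  · intro H
    rw [← H, Matrix.mulVec_mulVec, Units.inv_mul, Matrix.one_mulVec]

theorem mulVec_firstBasis {R : Type*} [CommRing R] (M : Matrix (Fin 2) (Fin 2) R) :
    M *ᵥ ![1, 0] = ![M 0 0, M 1 0] := by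
  ext i
  fin_cases i <;> simp [Matrix.mulVec, dotProduct, Fin.sum_univ_two]

theorem firstColumn_eq_iff {R : Type*} [CommRing R] (g h : GL (Fin 2) R) :
    (g.1 0 0, g.1 1 0) = (h.1 0 0, h.1 1 0) ↔ g⁻¹ * h ∈ mulVecStabilizer ![(1 : R), 0] := by
  rw [inv_mul_mem_mulVecStabilizer, mulVec_firstBasis, mulVec_firstBasis]
  simp

theorem map_eq_one_iff_entries {R S : Type*} [CommRing R] [CommRing S]
    (φ : R →+* S) (M : GL (Fin 2) R) :
    Matrix.GeneralLinearGroup.map (n := Fin 2) φ M = 1 ↔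
      φ (M.1 0 0) = 1 ∧ φ (M.1 0 1) = 0 ∧ φ (M.1 1 0) = 0 ∧ φ (M.1 1 1) = 1 := by
  rw [Matrix.GeneralLinearGroup.ext_iff]
  simp [Fin.forall_fin_two, Matrix.one_apply, and_assoc]

theorem image_firstColumn_ker {R S : Type*} [CommRing R] [CommRing S]
    (φ : R →+* S) :
    (fun M : GL (Fin 2) R => (M.1 0 0, M.1 1 0)) ''
        (Matrix.GeneralLinearGroup.map (n := Fin 2) φ).ker =
      {z : R × R | IsCoprime z.1 z.2 ∧ φ z.1 = 1 ∧ φ z.2 = 0} := by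
  ext ⟨a, c⟩
  constructor
  · rintro ⟨M, hM, h⟩
    obtain ⟨rfl, rfl⟩ := Prod.mk.inj h
    have hM := (map_eq_one_iff_entries φ M).1 hM
    refine ⟨?_, hM.1, hM.2.2.1⟩
    obtain ⟨u, hu⟩ : IsUnit M.1.det := (Matrix.isUnit_iff_isUnit_det _).1 M.isUnit
    rw [Matrix.det_fin_two] at hu
    refine ⟨u⁻¹ * M.1 1 1, -(u⁻¹ * M.1 0 1), ?_⟩
    have := u.inv_mul
    rw [hu] at this
    linear_combination this
  · rintro ⟨⟨x, y, h⟩, ha, hc⟩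
    simp only at h ha hc
    have hx : φ x = 1 := by
      have := congrArg φ h
      simpa [ha, hc] using this
    refine ⟨Matrix.GeneralLinearGroup.mk'' !![a, y * a - y; c, x + y * c] ?_, ?_, ?_⟩
    · have : (!![a, y * a - y; c, x + y * c]).det = 1 := by
        rw [Matrix.det_fin_two_of]
        linear_combination h
      rw [this]
      exact isUnit_one
    · refine (map_eq_one_iff_entries φ _).2 ?_
      simp [Matrix.GeneralLinearGroup.mk'', Matrix.nonsingInvUnit, ha, hc, hx]
    · simp [Matrix.GeneralLinearGroup.mk'', Matrix.nonsingInvUnit]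

theorem image_firstColumn_upperTriangular {R S : Type*} [CommRing R] [CommRing S]
    (φ : R →+* S) :
    (fun M : GL (Fin 2) R => (M.1 0 0, M.1 1 0)) ''
        (upperTriangularGL R ⊓ (Matrix.GeneralLinearGroup.map (n := Fin 2) φ).ker : Subgroup _) =
      (fun a => (a, 0)) '' {a : R | IsUnit a ∧ φ a = 1} := by
  ext ⟨a, c⟩
  constructor
  · rintro ⟨M, ⟨hM, hk⟩, h⟩
    have h' : (M.1 0 0, M.1 1 0) ∈ {z : R × R | IsCoprime z.1 z.2 ∧ φ z.1 = 1 ∧ φ z.2 = 0} :=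
      image_firstColumn_ker φ ▸ ⟨M, hk, rfl⟩
    obtain ⟨rfl, rfl⟩ := Prod.mk.inj h
    have h0 : M.1 1 0 = 0 := hM
    rw [h0] at h' ⊢
    exact ⟨_, ⟨isCoprime_zero_right.1 h'.1, h'.2.1⟩, rfl⟩
  · rintro ⟨a, ⟨hu, ha⟩, h⟩
    obtain ⟨rfl, rfl⟩ := Prod.mk.inj h
    have h' : (a, (0 : R)) ∈ {z : R × R | IsCoprime z.1 z.2 ∧ φ z.1 = 1 ∧ φ z.2 = 0} :=
      ⟨isCoprime_zero_right.2 hu, ha, map_zero φ⟩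
    rw [← image_firstColumn_ker φ] at h'
    obtain ⟨M, hM, h⟩ := h'
    exact ⟨M, ⟨(Prod.mk.inj h).2, hM⟩, h⟩

theorem relativeDegree_mul_prod {n : ℕ} (d : ℕ) (hn : n ≠ 0) :
    relativeDegree n d * ∏ p ∈ n.primeFactors.filter (fun p => ¬ p ∣ d), p =
      n * ∏ p ∈ n.primeFactors.filter (fun p => ¬ p ∣ d), (p + 1) := by
  have hfac : ∏ p ∈ n.primeFactors, p ^ n.factorization p = n :=
    Nat.prod_factorization_pow_eq_self hn
  conv_rhs => enter [1]; rw [← hfac]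
  rw [relativeDegree, Finset.prod_filter, Finset.prod_filter, ← Finset.prod_mul_distrib,
    ← Finset.prod_mul_distrib]
  refine Finset.prod_congr rfl fun p hp => ?_
  have hpos : 0 < n.factorization p :=
    (Nat.prime_of_mem_primeFactors hp).factorization_pos_of_dvd hn
      (Nat.dvd_of_mem_primeFactors hp)
  by_cases h : p ∣ d
  · simp [h]
  · simp only [h, not_false_eq_true, if_true, if_false]
    rw [mul_right_comm, ← pow_succ, Nat.sub_add_cancel hpos]

theorem relativeDegree_eq {n d : ℕ} (hn : n ≠ 0) (hdn : d ∣ n) :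
    relativeDegree n d =
      d * ((∏ p ∈ d.primeFactors, p ^ (n.factorization p - d.factorization p)) *
        ∏ p ∈ n.primeFactors.filter (fun p => ¬ p ∣ d), p ^ (n.factorization p - 1) * (p + 1)) := by
  have hd : d ≠ 0 := ne_zero_of_dvd_ne_zero hn hdn
  have hfac : ∏ p ∈ d.primeFactors, p ^ d.factorization p = d :=
    Nat.prod_factorization_pow_eq_self hd
  have hfilter : n.primeFactors.filter (fun p => p ∣ d) = d.primeFactors := by
    ext p
    simp only [Finset.mem_filter, Nat.mem_primeFactors]
    exact ⟨fun h => ⟨h.1.1, h.2, hd⟩, fun h => ⟨⟨h.1, h.2.1.trans hdn, hn⟩, h.2.1⟩⟩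
  rw [relativeDegree, Finset.prod_ite, hfilter, ← mul_assoc]
  congr 1
  conv_rhs => enter [1]; rw [← hfac]
  rw [← Finset.prod_mul_distrib]
  refine Finset.prod_congr rfl fun p _ => ?_
  rw [← pow_add, Nat.add_sub_cancel' ((Nat.factorization_le_iff_dvd hd hn).2 hdn p)]

theorem card_unit_kernel_mul {n d : ℕ} [NeZero n] (hdn : d ∣ n) :
    Nat.card {a : ZMod n | IsUnit a ∧ ZMod.castHom hdn (ZMod d) a = 1} * d =
      Nat.card {x : ZMod n // IsUnit (1 + d * x)} := by
  have h := card_subtype_comp_of_surjective (AddMonoidHom.mulLeft (d : ZMod n))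
    (fun u => IsUnit (1 + u) ∧ ZMod.castHom hdn (ZMod d) u = 0)
    (fun u hu => (range_mulLeft_natCast hdn u).2 hu.2)
  rw [card_ker_mulLeft_natCast hdn] at h
  have h1 : Nat.card {a : ZMod n | IsUnit a ∧ ZMod.castHom hdn (ZMod d) a = 1} =
      Nat.card {u : ZMod n // IsUnit (1 + u) ∧ ZMod.castHom hdn (ZMod d) u = 0} :=
    (Nat.card_congr ((Equiv.addLeft (1 : ZMod n)).subtypeEquiv fun u => by
      rw [Set.mem_ofPred_eq, Equiv.coe_addLeft, map_add, map_one, add_eq_left])).symm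
  rw [h1, ← h]
  refine Nat.card_congr (Equiv.subtypeEquivRight fun x => and_iff_left ?_)
  exact (range_mulLeft_natCast hdn _).1 ⟨x, rfl⟩

theorem card_unimodular_kernel_mul {n d : ℕ} [NeZero n] (hdn : d ∣ n) :
    Nat.card {z : ZMod n × ZMod n | IsCoprime z.1 z.2 ∧ ZMod.castHom hdn (ZMod d) z.1 = 1 ∧
        ZMod.castHom hdn (ZMod d) z.2 = 0} * (d * d) =
      Nat.card {z : ZMod n × ZMod n // IsCoprime (1 + d * z.1) z.2} := by
  set f := AddMonoidHom.mulLeft (d : ZMod n) with hf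
  have h := card_subtype_comp_of_surjective (f.prodMap f)
    (fun z => IsCoprime (1 + z.1) z.2 ∧ ZMod.castHom hdn (ZMod d) z.1 = 0 ∧
        ZMod.castHom hdn (ZMod d) z.2 = 0)
    (fun z hz => by
      obtain ⟨x, hx⟩ := (range_mulLeft_natCast hdn z.1).2 hz.2.1
      obtain ⟨y, hy⟩ := (range_mulLeft_natCast hdn z.2).2 hz.2.2
      exact ⟨(x, y), Prod.ext hx hy⟩)
  have hker : Nat.card (f.prodMap f).ker = d * d := by
    rw [AddMonoidHom.ker_prodMap, Nat.card_congr (AddSubgroup.prodEquiv _ _).toEquiv, Nat.card_prod,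
      card_ker_mulLeft_natCast hdn]
  rw [hker] at h
  have h1 : Nat.card {z : ZMod n × ZMod n | IsCoprime z.1 z.2 ∧
        ZMod.castHom hdn (ZMod d) z.1 = 1 ∧ ZMod.castHom hdn (ZMod d) z.2 = 0} =
      Nat.card {z : ZMod n × ZMod n // IsCoprime (1 + z.1) z.2 ∧
        ZMod.castHom hdn (ZMod d) z.1 = 0 ∧ ZMod.castHom hdn (ZMod d) z.2 = 0} :=
    (Nat.card_congr (((Equiv.addLeft (1 : ZMod n)).prodCongr (Equiv.refl _)).subtypeEquiv fun z => by
      rw [Set.mem_ofPred_eq, Equiv.prodCongr_apply, Prod.map_fst, Prod.map_snd, Equiv.coe_addLeft,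
        map_add, map_one, add_eq_left, Equiv.refl_apply])).symm
  rw [h1, ← h]
  refine Nat.card_congr (Equiv.subtypeEquivRight fun z => ?_)
  have h0 : ∀ x, ZMod.castHom hdn (ZMod d) (f x) = 0 := fun x =>
    (range_mulLeft_natCast hdn _).1 ⟨x, rfl⟩
  change IsCoprime (1 + d * z.1) (d * z.2) ∧ _ ↔ _
  rw [and_iff_left ⟨h0 z.1, h0 z.2⟩, IsCoprime.mul_right_iff]
  exact and_iff_right ⟨1, -z.1, by ring⟩

theorem card_ker_mul_eq {n d : ℕ} [NeZero n] (hdn : d ∣ n) :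
    Nat.card (Matrix.GeneralLinearGroup.map (n := Fin 2) (ZMod.castHom hdn (ZMod d))).ker * d =
      Nat.card {M : GL (Fin 2) (ZMod n) //
          (M : Matrix (Fin 2) (Fin 2) (ZMod n)) 1 0 = 0 ∧
          Matrix.GeneralLinearGroup.map (n := Fin 2) (ZMod.castHom hdn (ZMod d)) M = 1} *
        relativeDegree n d := by
  have hd : 0 < d := Nat.pos_of_ne_zero (ne_zero_of_dvd_ne_zero (NeZero.ne n) hdn)
  set φ := ZMod.castHom hdn (ZMod d)
  set K := (Matrix.GeneralLinearGroup.map (n := Fin 2) φ).ker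
  set B := upperTriangularGL (ZMod n) ⊓ K
  set S := mulVecStabilizer ![(1 : ZMod n), 0] ⊓ K
  have hSB : S ≤ B := fun M hM => by
    refine ⟨?_, hM.2⟩
    have h : M.1 *ᵥ ![1, 0] = ![1, 0] := hM.1
    rw [mulVec_firstBasis] at h
    exact congrFun h 1
  have hf : ∀ g ∈ K, ∀ h ∈ K, (g.1 0 0, g.1 1 0) = (h.1 0 0, h.1 1 0) ↔ g⁻¹ * h ∈ S :=
    fun g hg h hh => by
      rw [firstColumn_eq_iff, Subgroup.mem_inf, and_iff_left (K.mul_mem (K.inv_mem hg) hh)]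
  have hK := card_subgroup_eq_card_image_mul K S inf_le_right
    (fun M => (M.1 0 0, M.1 1 0)) hf
  have hB := card_subgroup_eq_card_image_mul B S hSB
    (fun M => (M.1 0 0, M.1 1 0)) (fun g hg h hh => hf g hg.2 h hh.2)
  rw [image_firstColumn_ker] at hK
  rw [image_firstColumn_upperTriangular,
    Nat.card_image_of_injective (fun a b h => (Prod.mk.inj h).1)] at hB
  have hB' : Nat.card {M : GL (Fin 2) (ZMod n) //
      (M : Matrix (Fin 2) (Fin 2) (ZMod n)) 1 0 = 0 ∧
      Matrix.GeneralLinearGroup.map (n := Fin 2) φ M = 1} = Nat.card B := rfl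
  have hC := card_unimodular_kernel_mul hdn
  rw [card_pairs_isCoprime_one_add d n (NeZero.ne n), ← card_unit_kernel_mul hdn] at hC
  rw [hB', hK, hB]
  refine Nat.eq_of_mul_eq_mul_right hd ?_
  linear_combination Nat.card S * hC

/-- For positive integers `d ∣ n`, let `K_GL` be the kernel of the entrywise reduction
`GL₂(ℤ/nℤ) → GL₂(ℤ/dℤ)` and `K_B` the kernel of the entrywise reduction `B(n) → B(d)`
between the subgroups of upper-triangular matrices. Then
`#K_GL * d * ∏_{p ∣ n, p ∤ d} p = #K_B * n * ∏_{p ∣ n, p ∤ d} (p + 1)`; equivalently,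
`#K_GL = #K_B * ∏_{p ∣ d} p^(a_p - b_p) * ∏_{p ∣ n, p ∤ d} p^(a_p - 1) (p + 1)`,
the latter factor being the degree of the natural map `X₀(n) → X₀(d)`. -/
theorem card_ker_GL_div_card_ker_upperTriangular
    (n d : ℕ) (hn : 0 < n) (hd : 0 < d) (hdn : d ∣ n) :
    Nat.card
          (Matrix.GeneralLinearGroup.map (n := Fin 2) (ZMod.castHom hdn (ZMod d))).ker * d *
        ∏ p ∈ n.primeFactors.filter (fun p => ¬ p ∣ d), p =
      Nat.card {M : GL (Fin 2) (ZMod n) //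
          (M : Matrix (Fin 2) (Fin 2) (ZMod n)) 1 0 = 0 ∧
          Matrix.GeneralLinearGroup.map (n := Fin 2) (ZMod.castHom hdn (ZMod d)) M = 1} * n *
        ∏ p ∈ n.primeFactors.filter (fun p => ¬ p ∣ d), (p + 1) ∧
    Nat.card
        (Matrix.GeneralLinearGroup.map (n := Fin 2) (ZMod.castHom hdn (ZMod d))).ker =
      Nat.card {M : GL (Fin 2) (ZMod n) //
          (M : Matrix (Fin 2) (Fin 2) (ZMod n)) 1 0 = 0 ∧
          Matrix.GeneralLinearGroup.map (n := Fin 2) (ZMod.castHom hdn (ZMod d)) M = 1} *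
        ((∏ p ∈ d.primeFactors, p ^ (n.factorization p - d.factorization p)) *
          ∏ p ∈ n.primeFactors.filter (fun p => ¬ p ∣ d),
            p ^ (n.factorization p - 1) * (p + 1)) := by
  have : NeZero n := ⟨hn.ne'⟩
  have h := card_ker_mul_eq hdn
  constructor
  · rw [h, mul_assoc, relativeDegree_mul_prod d hn.ne', mul_assoc]
  · rw [relativeDegree_eq hn.ne' hdn] at h
    refine Nat.eq_of_mul_eq_mul_right hd (h.trans ?_)
    ring
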